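/- arXiv:2308.14802 — 2 statements merged into one kernel-verified Lean document; each statement's English description precedes it below -/
import Mathlib

section
/- Bubble (1-loop melon) integral: for complex exponents s₁, s₂ with 3/4 < Re sᵢ < 3/2 and Re(s₁+s₂) > 3/2, and P > 0, ∫_{ℝ³} d³q/(2π)³ |q|^{−2s₁} |P − q|^{−2s₂} = P^{3−2(s₁+s₂)} / (4π)^{3/2} · Γ(s₁+s₂−3/2) Γ(3/2−s₁) Γ(3/2−s₂) / (Γ(3−s₁−s₂) Γ(s₁) Γ(s₂)). -/
open MeasureTheory

/-- Complex powers of positive reals, through the real logarithm. -/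
lemma cpw {x : ℝ} (hx : 0 < x) (z : ℂ) : (x : ℂ) ^ z = Complex.exp ((Real.log x : ℂ) * z) := by
  rw [Complex.cpow_def_of_ne_zero (by exact_mod_cast hx.ne'), Complex.ofReal_log hx.le]

lemma cexp_log {x : ℝ} (hx : 0 < x) : (x : ℂ) = Complex.exp ((Real.log x : ℂ)) := by
  rw [← Complex.ofReal_exp, Real.exp_log hx]

/-- The integrand of the second form of the beta integral. -/
noncomputable def bp (a b : ℂ) (v : ℝ) : ℂ :=
  (v : ℂ) ^ (a - 1) * ((1 + v : ℝ) : ℂ) ^ (-(a + b))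

lemma bp_image : (fun x : ℝ => x / (1 - x)) '' Set.Ioo 0 1 = Set.Ioi 0 := by
  ext v
  simp only [Set.mem_image, Set.mem_Ioo, Set.mem_Ioi]
  constructor
  · rintro ⟨x, ⟨h0, h1⟩, rfl⟩
    exact div_pos h0 (by linarith)
  · intro hv
    refine ⟨v / (1 + v), ⟨by positivity, ?_⟩, ?_⟩
    · rw [div_lt_one (by positivity)]; linarith
    · have : 1 + v ≠ 0 := by positivity
      have : 1 - v / (1 + v) = 1 / (1 + v) := by field_simp; ring
      rw [this]; field_simp

lemma bp_deriv : ∀ x ∈ Set.Ioo (0 : ℝ) 1,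
    HasDerivWithinAt (fun x : ℝ => x / (1 - x)) (1 / (1 - x) ^ 2) (Set.Ioo 0 1) x := by
  intro x hx
  have h : (1 - x) ≠ 0 := by linarith [hx.2]
  have := ((hasDerivAt_id x).div ((hasDerivAt_const x (1 : ℝ)).sub (hasDerivAt_id x)) h)
  refine (this.congr_deriv ?_).hasDerivWithinAt
  simp

lemma bp_inj : Set.InjOn (fun x : ℝ => x / (1 - x)) (Set.Ioo 0 1) := by
  intro x hx y hy h
  have h1 : (1 - x) ≠ 0 := by linarith [hx.2]
  have h2 : (1 - y) ≠ 0 := by linarith [hy.2]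
  simp only at h
  rw [div_eq_div_iff h1 h2] at h
  linarith

lemma bp_subst (a b : ℂ) : Set.EqOn
    (fun x : ℝ => |1 / (1 - x) ^ 2| • bp a b (x / (1 - x)))
    (fun x : ℝ => (x : ℂ) ^ (a - 1) * (1 - (x : ℂ)) ^ (b - 1)) (Set.Ioo 0 1) := by
  intro x hx
  have h0 := hx.1
  have h1 : 0 < 1 - x := by linarith [hx.2]
  have e : 1 + x / (1 - x) = 1 / (1 - x) := by field_simp; ring
  have e2 : (1 - (x : ℂ)) = ((1 - x : ℝ) : ℂ) := by push_cast; ring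
  simp only [bp]
  rw [e, abs_of_pos (by positivity), Complex.real_smul, e2, cpw (by positivity), cpw (by positivity),
    cpw h0, cpw h1, cexp_log (x := 1 / (1 - x) ^ 2) (by positivity), ← Complex.exp_add,
    ← Complex.exp_add, ← Complex.exp_add]
  congr 1
  rw [Real.log_div h0.ne' h1.ne', Real.log_div one_ne_zero h1.ne',
    Real.log_div one_ne_zero (by positivity), Real.log_pow]
  push_cast
  simp only [Real.log_one]
  push_cast
  ring

lemma bp_integrable {a b : ℂ} (ha : 0 < a.re) (hb : 0 < b.re) :
    IntegrableOn (bp a b) (Set.Ioi 0) := by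
  rw [← bp_image, integrableOn_image_iff_integrableOn_abs_deriv_smul measurableSet_Ioo bp_deriv
    bp_inj, integrableOn_congr_fun (bp_subst a b) measurableSet_Ioo]
  have := Complex.betaIntegral_convergent ha hb
  rwa [intervalIntegrable_iff_integrableOn_Ioo_of_le zero_le_one] at this

lemma bp_integral (a b : ℂ) :
    ∫ v in Set.Ioi (0 : ℝ), bp a b v = Complex.betaIntegral a b := by
  rw [← bp_image, integral_image_eq_integral_abs_deriv_smul measurableSet_Ioo bp_deriv
    bp_inj, setIntegral_congr_fun measurableSet_Ioo (bp_subst a b), Complex.betaIntegral,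
    intervalIntegral.integral_of_le zero_le_one, integral_Ioc_eq_integral_Ioo]

lemma bp2_subst (a b : ℂ) {A B : ℝ} (hA : 0 < A) (hB : 0 < B) : Set.EqOn
    (fun v : ℝ => (v : ℂ) ^ (a - 1) * ((A + v * B : ℝ) : ℂ) ^ (-(a + b)))
    (fun v : ℝ => ((A : ℂ) ^ (-(a + b)) * ((B / A : ℝ) : ℂ) ^ (1 - a)) * bp a b (B / A * v))
    (Set.Ioi 0) := by
  intro v hv
  have hv : 0 < v := hv
  have e : A + v * B = A * (1 + B / A * v) := by field_simp
  simp only [bp]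
  rw [e, cpw hv, cpw (by positivity), cpw hA, cpw (by positivity), cpw (by positivity),
    cpw (by positivity), ← Complex.exp_add, ← Complex.exp_add, ← Complex.exp_add, ← Complex.exp_add]
  congr 1
  rw [Real.log_mul hA.ne' (by positivity), Real.log_mul (by positivity) hv.ne']
  push_cast
  ring

lemma bp2_integrable {a b : ℂ} (ha : 0 < a.re) (hb : 0 < b.re) {A B : ℝ} (hA : 0 < A)
    (hB : 0 < B) : IntegrableOn
    (fun v : ℝ => (v : ℂ) ^ (a - 1) * ((A + v * B : ℝ) : ℂ) ^ (-(a + b))) (Set.Ioi 0) := by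
  rw [integrableOn_congr_fun (bp2_subst a b hA hB) measurableSet_Ioi]
  apply Integrable.const_mul
  have := (integrableOn_Ioi_comp_mul_left_iff (bp a b) 0 (a := B / A) (by positivity)).2
  simp only [mul_zero] at this
  exact this (bp_integrable ha hb)

lemma bp2_integral (a b : ℂ) {A B : ℝ} (hA : 0 < A) (hB : 0 < B) :
    ∫ v in Set.Ioi (0 : ℝ), (v : ℂ) ^ (a - 1) * ((A + v * B : ℝ) : ℂ) ^ (-(a + b))
      = (A : ℂ) ^ (-b) * (B : ℂ) ^ (-a) * Complex.betaIntegral a b := by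
  rw [setIntegral_congr_fun measurableSet_Ioi (bp2_subst a b hA hB), integral_const_mul,
    integral_comp_mul_left_Ioi _ _ (by positivity), mul_zero, bp_integral, Complex.real_smul,
    ← mul_assoc]
  congr 1
  rw [cpw hA, cpw hA, cpw hB, cpw (by positivity), cexp_log (x := (B / A)⁻¹) (by positivity),
    ← Complex.exp_add, ← Complex.exp_add, ← Complex.exp_add]
  congr 1
  rw [Real.log_inv, Real.log_div hB.ne' hA.ne']
  push_cast
  ring


lemma rad_subst (s : ℂ) {C : ℝ} : Set.EqOn
    (fun y : ℝ => y ^ ((2 : ℝ) - 1) • ((fun v : ℝ => (v : ℂ) ^ ((3 / 2 : ℂ) - 1) *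
      ((C + v * 1 : ℝ) : ℂ) ^ (-((3 / 2 : ℂ) + (s - 3 / 2)))) (y ^ (2 : ℝ))))
    (fun y : ℝ => y ^ (Module.finrank ℝ (EuclideanSpace ℝ (Fin 3)) - 1) • (((y ^ 2 + C : ℝ) : ℂ) ^ (-s))) (Set.Ioi 0) := by
  intro y hy
  have hy : 0 < y := hy
  have e : (2 : ℝ) - 1 = 1 := by norm_num
  have e2 : -((3 / 2 : ℂ) + (s - 3 / 2)) = -s := by ring
  have e3 : (((y ^ 2 : ℝ)) : ℂ) ^ ((3 / 2 : ℂ) - 1) = (y : ℂ) := by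
    rw [cpw (by positivity), cexp_log hy, Real.log_pow]
    congr 1
    push_cast
    ring
  simp only [Complex.real_smul, finrank_euclideanSpace, Fintype.card_fin]
  rw [e, e2, Real.rpow_one, Real.rpow_two, e3, mul_one, add_comm C]
  push_cast
  ring

lemma rad_integrable {s : ℂ} (hs : 3 / 2 < s.re) {C : ℝ} (hC : 0 < C) :
    Integrable (fun q : EuclideanSpace ℝ (Fin 3) => ((‖q‖ ^ 2 + C : ℝ) : ℂ) ^ (-s)) := by
  have := (integrable_fun_norm_addHaar (volume : Measure (EuclideanSpace ℝ (Fin 3)))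
    (f := fun y : ℝ => ((y ^ 2 + C : ℝ) : ℂ) ^ (-s))).2
  apply this
  rw [← integrableOn_congr_fun (rad_subst s) measurableSet_Ioi]
  refine (integrableOn_Ioi_comp_rpow_iff' (fun v : ℝ => (v : ℂ) ^ ((3 / 2 : ℂ) - 1) *
      ((C + v * 1 : ℝ) : ℂ) ^ (-((3 / 2 : ℂ) + (s - 3 / 2)))) two_ne_zero).2 ?_
  apply bp2_integrable _ _ hC one_pos
  · norm_num
  · simp only [Complex.sub_re]; norm_num; linarith

/-- The constant in the radial integral. -/
noncomputable def Kc (s : ℂ) : ℂ := 2 * Real.pi * Complex.betaIntegral (3 / 2) (s - 3 / 2)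

lemma rad_integral (s : ℂ) {C : ℝ} (hC : 0 < C) :
    ∫ q : EuclideanSpace ℝ (Fin 3), ((‖q‖ ^ 2 + C : ℝ) : ℂ) ^ (-s) = Kc s * (C : ℂ) ^ (3 / 2 - s) := by
  have := (integral_fun_norm_addHaar (volume : Measure (EuclideanSpace ℝ (Fin 3)))
    (fun y : ℝ => ((y ^ 2 + C : ℝ) : ℂ) ^ (-s)))
  rw [this, ← setIntegral_congr_fun measurableSet_Ioi (rad_subst s)]
  have h2 := integral_comp_rpow_Ioi_of_pos (g := fun v : ℝ => (v : ℂ) ^ ((3 / 2 : ℂ) - 1) *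
      ((C + v * 1 : ℝ) : ℂ) ^ (-((3 / 2 : ℂ) + (s - 3 / 2)))) (two_pos)
  simp only [mul_smul] at h2
  rw [integral_smul, bp2_integral _ _ hC one_pos] at h2
  have hb : (volume : Measure (EuclideanSpace ℝ (Fin 3))).real (Metric.ball 0 1) = Real.pi * 4 / 3 := by
    rw [Measure.real, EuclideanSpace.volume_ball_fin_three]
    simp
    positivity
  have h3 : ∀ X Y : ℂ, (2 : ℝ) • X = Y → X = Y / 2 := by
    intro X Y h; rw [← h, Complex.real_smul]; push_cast; ring
  rw [h3 _ _ h2, hb, finrank_euclideanSpace, Fintype.card_fin, Kc]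
  rw [show (-(s - 3 / 2)) = 3 / 2 - s by ring]
  simp only [Complex.real_smul, nsmul_eq_mul]
  push_cast
  rw [Complex.one_cpow]
  ring

lemma quad_eq (P q : EuclideanSpace ℝ (Fin 3)) {v : ℝ} (hv : 0 < v) : ‖q‖ ^ 2 + v * ‖P - q‖ ^ 2 =
    (1 + v) * (‖q - (v / (1 + v)) • P‖ ^ 2 + v / (1 + v) ^ 2 * ‖P‖ ^ 2) := by
  rw [norm_sub_sq_real, norm_sub_sq_real, inner_smul_right, norm_smul, real_inner_comm,
    Real.norm_of_nonneg (by positivity)]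
  field_simp
  ring

lemma quad_fun (P : EuclideanSpace ℝ (Fin 3)) (s : ℂ) {v : ℝ} (hv : 0 < v) (hP : P ≠ 0) :
    (fun q : EuclideanSpace ℝ (Fin 3) => ((‖q‖ ^ 2 + v * ‖P - q‖ ^ 2 : ℝ) : ℂ) ^ (-s)) =
    fun q : EuclideanSpace ℝ (Fin 3) => ((1 + v : ℝ) : ℂ) ^ (-s) *
      (fun q : EuclideanSpace ℝ (Fin 3) => ((‖q‖ ^ 2 + v / (1 + v) ^ 2 * ‖P‖ ^ 2 : ℝ) : ℂ) ^ (-s))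
        (q - (v / (1 + v)) • P) := by
  ext q
  have hP' : 0 < ‖P‖ := norm_pos_iff.2 hP
  rw [quad_eq P q hv]
  simp only
  rw [Complex.ofReal_mul, Complex.mul_cpow_ofReal_nonneg (by positivity) (by positivity)]

lemma quad_integrable (P : EuclideanSpace ℝ (Fin 3)) {s : ℂ} (hs : 3 / 2 < s.re) {v : ℝ} (hv : 0 < v) (hP : P ≠ 0) :
    Integrable (fun q : EuclideanSpace ℝ (Fin 3) => ((‖q‖ ^ 2 + v * ‖P - q‖ ^ 2 : ℝ) : ℂ) ^ (-s)) := by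
  have hP' : 0 < ‖P‖ := norm_pos_iff.2 hP
  rw [quad_fun P s hv hP]
  exact ((rad_integrable hs (by positivity)).comp_sub_right _).const_mul _

lemma quad_integral (P : EuclideanSpace ℝ (Fin 3)) (s : ℂ) {v : ℝ} (hv : 0 < v) (hP : P ≠ 0) :
    ∫ q : EuclideanSpace ℝ (Fin 3), ((‖q‖ ^ 2 + v * ‖P - q‖ ^ 2 : ℝ) : ℂ) ^ (-s) =
    Kc s * (‖P‖ : ℂ) ^ (3 - 2 * s) * ((v : ℂ) ^ (3 / 2 - s) * ((1 + v : ℝ) : ℂ) ^ (s - 3)) := by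
  have hP' : 0 < ‖P‖ := norm_pos_iff.2 hP
  rw [quad_fun P s hv hP, integral_const_mul,
    integral_sub_right_eq_self (fun q : EuclideanSpace ℝ (Fin 3) =>
      ((‖q‖ ^ 2 + v / (1 + v) ^ 2 * ‖P‖ ^ 2 : ℝ) : ℂ) ^ (-s)), rad_integral s (by positivity)]
  rw [cpw (by positivity), cpw (by positivity), cpw hP', cpw hv, cpw (by positivity),
    Real.log_mul (by positivity) (by positivity), Real.log_div (by positivity) (by positivity),
    Real.log_pow, Real.log_pow, ← Complex.exp_add, mul_left_comm, ← Complex.exp_add, mul_assoc,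
    ← Complex.exp_add]
  congr 2
  push_cast
  ring

/-- The Feynman-parametrized integrand. -/
noncomputable def Gf (s₁ s₂ : ℂ) (P : EuclideanSpace ℝ (Fin 3)) (v : ℝ) (q : EuclideanSpace ℝ (Fin 3)) : ℂ :=
  (v : ℂ) ^ (s₂ - 1) * ((‖q‖ ^ 2 + v * ‖P - q‖ ^ 2 : ℝ) : ℂ) ^ (-(s₂ + s₁))

lemma Gf_integral (s₁ s₂ : ℂ) {P : EuclideanSpace ℝ (Fin 3)} (hP : P ≠ 0) {v : ℝ} (hv : 0 < v) :
    ∫ q, Gf s₁ s₂ P v q =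
      Kc (s₂ + s₁) * (‖P‖ : ℂ) ^ (3 - 2 * (s₂ + s₁)) * bp (3 / 2 - s₁) (3 / 2 - s₂) v := by
  simp only [Gf, bp]
  rw [integral_const_mul, quad_integral P _ hv hP, mul_left_comm, ← mul_assoc (_ ^ (s₂ - 1)),
    cpw hv, cpw hv, cpw hv, ← Complex.exp_add]
  congr 3
  · ring
  · ring

lemma Gf_norm (s₁ s₂ : ℂ) {P : EuclideanSpace ℝ (Fin 3)} (hP : P ≠ 0) {v : ℝ} (hv : 0 < v) (q : EuclideanSpace ℝ (Fin 3)) :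
    ((‖Gf s₁ s₂ P v q‖ : ℝ) : ℂ) = Gf s₁.re s₂.re P v q := by
  have hP' : 0 < ‖P‖ := norm_pos_iff.2 hP
  have h : 0 < ‖q‖ ^ 2 + v * ‖P - q‖ ^ 2 := by rw [quad_eq P q hv]; positivity
  simp only [Gf]
  rw [norm_mul, Complex.norm_cpow_eq_rpow_re_of_pos hv, Complex.norm_cpow_eq_rpow_re_of_pos h,
    Complex.ofReal_mul, Complex.ofReal_cpow hv.le, Complex.ofReal_cpow h.le]
  simp

lemma Gf_integrable {s₁ s₂ : ℂ} (h₁u : s₁.re < 3 / 2) (h₂u : s₂.re < 3 / 2)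
    (hsum : 3 / 2 < (s₁ + s₂).re) {P : EuclideanSpace ℝ (Fin 3)} (hP : P ≠ 0) :
    Integrable (Function.uncurry (Gf s₁ s₂ P)) ((volume.restrict (Set.Ioi 0)).prod volume) := by
  have hm : Measurable (Function.uncurry (Gf s₁ s₂ P)) := by
    unfold Gf Function.uncurry
    fun_prop
  rw [integrable_prod_iff hm.aestronglyMeasurable]
  constructor
  · filter_upwards [ae_restrict_mem measurableSet_Ioi] with v hv
    exact (quad_integrable P (s := s₂ + s₁) (by rwa [add_comm]) hv hP).const_mul ((v : ℂ) ^ (s₂ - 1))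
  · have h : IntegrableOn (fun v : ℝ => ((∫ q, ‖Gf s₁ s₂ P v q‖ : ℝ) : ℂ)) (Set.Ioi 0) := by
      have e : Set.EqOn (fun v : ℝ => ((∫ q, ‖Gf s₁ s₂ P v q‖ : ℝ) : ℂ))
          (fun v => Kc (s₂.re + s₁.re) * (‖P‖ : ℂ) ^ (3 - 2 * ((s₂.re : ℂ) + s₁.re)) *
            bp (3 / 2 - s₁.re) (3 / 2 - s₂.re) v) (Set.Ioi 0) := by
        intro v hv
        simp only
        rw [← Gf_integral _ _ hP hv, ← integral_complex_ofReal]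
        congr 1
        ext q
        exact Gf_norm s₁ s₂ hP hv q
      rw [integrableOn_congr_fun e measurableSet_Ioi]
      apply Integrable.const_mul
      apply bp_integrable
      · norm_num; exact h₁u
      · norm_num; exact h₂u
    exact h.re

lemma norm_sq_cpow {x : ℝ} (hx : 0 < x) (s : ℂ) : ((x ^ 2 : ℝ) : ℂ) ^ (-s) = (x : ℂ) ^ (-2 * s) := by
  rw [cpw hx, cpw (by positivity), Real.log_pow]
  congr 1
  push_cast
  ring

/-- Bubble (1-loop melon) integral: for complex exponents `s₁, s₂` with
`3/4 < Re sᵢ < 3/2` and `Re(s₁+s₂) > 3/2`, and a nonzero vector `P ∈ ℝ³` with `P = |P|`,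
`∫ d³q/(2π)³ |q|^{−2s₁}|P−q|^{−2s₂}
  = P^{3−2(s₁+s₂)}/(4π)^{3/2} · Γ(s₁+s₂−3/2)Γ(3/2−s₁)Γ(3/2−s₂)/(Γ(3−s₁−s₂)Γ(s₁)Γ(s₂))`. -/
theorem stmt6 (s₁ s₂ : ℂ) (h₁l : 3 / 4 < s₁.re) (h₁u : s₁.re < 3 / 2)
    (h₂l : 3 / 4 < s₂.re) (h₂u : s₂.re < 3 / 2) (hsum : 3 / 2 < (s₁ + s₂).re)
    (P : EuclideanSpace ℝ (Fin 3)) (hP : P ≠ 0) :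
    (1 / (2 * (Real.pi : ℂ)) ^ 3) *
        ∫ q : EuclideanSpace ℝ (Fin 3),
          ((‖q‖ : ℝ) : ℂ) ^ (-2 * s₁) * ((‖P - q‖ : ℝ) : ℂ) ^ (-2 * s₂)
      = ((‖P‖ : ℝ) : ℂ) ^ (3 - 2 * (s₁ + s₂)) / (((4 * Real.pi) ^ ((3 : ℝ) / 2) : ℝ) : ℂ) *
        (Complex.Gamma (s₁ + s₂ - 3 / 2) * Complex.Gamma (3 / 2 - s₁) *
            Complex.Gamma (3 / 2 - s₂) /
          (Complex.Gamma (3 - s₁ - s₂) * Complex.Gamma s₁ * Complex.Gamma s₂)) := by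
  have hre : 3 / 2 < (s₂ + s₁).re := by rwa [add_comm]
  have swap := integral_integral_swap (Gf_integrable h₁u h₂u hsum hP)
  rw [setIntegral_congr_fun measurableSet_Ioi (fun v hv => Gf_integral s₁ s₂ hP hv),
    integral_const_mul, bp_integral] at swap
  have hae : ∀ᵐ q : EuclideanSpace ℝ (Fin 3), ∫ v in Set.Ioi (0 : ℝ), Gf s₁ s₂ P v q =
      ((‖q‖ : ℝ) : ℂ) ^ (-2 * s₁) * ((‖P - q‖ : ℝ) : ℂ) ^ (-2 * s₂) *
        Complex.betaIntegral s₂ s₁ := by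
    filter_upwards [Measure.ae_ne volume 0, Measure.ae_ne volume P] with q hq hqP
    have h1 : 0 < ‖q‖ := norm_pos_iff.2 hq
    have h2 : 0 < ‖P - q‖ := norm_pos_iff.2 (sub_ne_zero.2 (Ne.symm hqP))
    rw [← norm_sq_cpow h1, ← norm_sq_cpow h2]
    exact bp2_integral s₂ s₁ (by positivity) (by positivity)
  rw [integral_congr_ae hae, integral_mul_const] at swap
  set I := ∫ q : EuclideanSpace ℝ (Fin 3),
          ((‖q‖ : ℝ) : ℂ) ^ (-2 * s₁) * ((‖P - q‖ : ℝ) : ℂ) ^ (-2 * s₂) with hI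
  have p1 : 0 < s₁.re := by linarith
  have p2 : 0 < s₂.re := by linarith
  have g1 := Complex.Gamma_ne_zero_of_re_pos p1
  have g2 := Complex.Gamma_ne_zero_of_re_pos p2
  have g12 : Complex.Gamma (s₂ + s₁) ≠ 0 := Complex.Gamma_ne_zero_of_re_pos (by linarith)
  have g3 : Complex.Gamma (3 - s₁ - s₂) ≠ 0 := Complex.Gamma_ne_zero_of_re_pos (by
    simp only [Complex.sub_re]; norm_num; linarith)
  have gh : Complex.Gamma (3 / 2) = (Real.pi : ℂ) ^ (1 / 2 : ℂ) / 2 := by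
    have := Complex.Gamma_add_one (1 / 2) (by norm_num)
    rw [Complex.Gamma_one_half_eq] at this
    rw [show (3 / 2 : ℂ) = 1 / 2 + 1 by norm_num, this]
    ring
  rw [Kc, Complex.betaIntegral_eq_Gamma_mul_div _ _ p2 p1,
    Complex.betaIntegral_eq_Gamma_mul_div _ _ (by norm_num)
      (by simp only [Complex.sub_re]; norm_num; linarith),
    Complex.betaIntegral_eq_Gamma_mul_div _ _ (by simp only [Complex.sub_re]; norm_num; linarith)
      (by simp only [Complex.sub_re]; norm_num; linarith),
    show (3 / 2 : ℂ) + (s₂ + s₁ - 3 / 2) = s₂ + s₁ by ring,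
    show (3 / 2 : ℂ) - s₁ + (3 / 2 - s₂) = 3 - s₁ - s₂ by ring, gh] at swap
  rw [add_comm s₁ s₂]
  have hpi : (Real.pi : ℂ) ≠ 0 := by exact_mod_cast Real.pi_pos.ne'
  have hr : (((4 * Real.pi) ^ ((3 : ℝ) / 2) : ℝ) : ℂ) = 8 * Real.pi * (Real.pi : ℂ) ^ (1 / 2 : ℂ) := by
    have e : (4 * Real.pi) ^ ((3 : ℝ) / 2) = 8 * Real.pi * Real.pi ^ ((1 : ℝ) / 2) := by
      rw [Real.mul_rpow (by norm_num) Real.pi_pos.le, show (4 : ℝ) = 2 ^ (2 : ℝ) by norm_num,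
        ← Real.rpow_mul (by norm_num), show (3 : ℝ) / 2 = 1 + 1 / 2 by norm_num,
        Real.rpow_add Real.pi_pos, Real.rpow_one]
      norm_num
      ring
    rw [e]
    push_cast
    rw [Complex.ofReal_cpow Real.pi_pos.le]
    push_cast
    ring
  have hsq : (Real.pi : ℂ) ^ (1 / 2 : ℂ) * (Real.pi : ℂ) ^ (1 / 2 : ℂ) = Real.pi := by
    rw [← Complex.cpow_add _ _ hpi]; norm_num
  have hr0 : (Real.pi : ℂ) ^ (1 / 2 : ℂ) ≠ 0 := by
    intro h; rw [h] at hsq; simp at hsq; exact hpi hsq.symm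
  rw [hr]
  have hIe : I = _ := eq_div_of_mul_eq (by simp [g1, g2, g12]) swap.symm
  rw [hIe]
  generalize (Real.pi : ℂ) ^ (1 / 2 : ℂ) = r at *
  rw [← hsq]
  field_simp
  try ring
end

section
/- Divergent part of a general Mellin-space loop integral: let L(s) = ∫ d³q/(2π)³ ∏_{i=1}^N |q + pᵢ|^{−2wᵢ} with fixed vectors pᵢ ∈ ℝ³. Then, as a meromorphic function of W = Σᵢ wᵢ, L has a simple pole at W = 3/2 with residue Res_{W=3/2} L = 1/(4π²), independent of the pᵢ. -/
open MeasureTheory Filter Topology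


/-- Holomorphy of dominated parameter integrals. -/
lemma aux_holo {α : Type*} [MeasurableSpace α] (μ : Measure α) (f : ℂ → α → ℂ) (z₀ : ℂ) (r : ℝ)
    (hmeas : ∀ z, AEStronglyMeasurable (f z) μ)
    (hdiff : ∀ᵐ a ∂μ, Differentiable ℂ (fun z => f z a))
    (b : α → ℝ) (hb : Integrable b μ)
    (hbound : ∀ᵐ a ∂μ, ∀ z ∈ Metric.ball z₀ r, ‖f z a‖ ≤ b a) :
    ∀ z ∈ Metric.ball z₀ r, DifferentiableAt ℂ (fun z => ∫ a, f z a ∂μ) z := by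
  intro z hz
  obtain ⟨ε, hε, hsub⟩ := Metric.isOpen_iff.1 Metric.isOpen_ball z hz
  have hd : AEStronglyMeasurable (fun a => deriv (fun z => f z a) z) μ := by
    have hlim : Tendsto (fun n : ℕ => (1 / ((n : ℂ) + 1))) atTop (𝓝[≠] 0) := by
      rw [tendsto_nhdsWithin_iff]
      refine ⟨tendsto_one_div_add_atTop_nhds_zero_nat, Eventually.of_forall fun n => ?_⟩
      have : ((n : ℂ) + 1) ≠ 0 := by exact_mod_cast Nat.succ_ne_zero n
      simp [this]
    refine aestronglyMeasurable_of_tendsto_ae (u := atTop)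
      (f := fun (n : ℕ) a => (1 / ((n : ℂ) + 1))⁻¹ • (f (z + 1 / ((n : ℂ) + 1)) a - f z a)) ?_ ?_
    · intro n
      exact ((hmeas _).sub (hmeas _)).const_smul ((1 / ((n : ℂ) + 1))⁻¹)
    · filter_upwards [hdiff] with a hda
      exact ((hda z).hasDerivAt.tendsto_slope_zero).comp hlim
  have key := hasDerivAt_integral_of_dominated_loc_of_deriv_le (μ := μ) (F := f) (x₀ := z)
    (s := Metric.ball z (ε / 2)) (bound := fun a => b a / (ε / 2))
    (F' := fun z a => deriv (fun z => f z a) z)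
    (Metric.ball_mem_nhds _ (by positivity)) (Eventually.of_forall hmeas)
    (hb.mono' (hmeas z) (hbound.mono fun a h => h z hz)) hd ?_ (hb.div_const _) ?_
  · exact key.2.differentiableAt
  · filter_upwards [hbound, hdiff] with a ha hda x hx
    refine Complex.norm_deriv_le_of_forall_mem_sphere_norm_le (by positivity)
      hda.diffContOnCl ?_
    intro y hy
    apply ha; apply hsub
    rw [Metric.mem_ball] at *
    rw [mem_sphere_iff_norm, ← dist_eq_norm] at hy
    linarith [dist_triangle y x z]
  · exact hdiff.mono fun a hda x hx => (hda x).hasDerivAt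

open Set in
lemma aux_radial_int (R : ℝ) (hR : 0 < R) (s : ℂ) :
    IntegrableOn (fun q : EuclideanSpace ℝ (Fin 3) => ((‖q‖ : ℝ) : ℂ) ^ s) (Metric.closedBall 0 R)ᶜ
      ↔ s.re < -3 := by
  rw [← integrable_indicator_iff Metric.isClosed_closedBall.measurableSet.compl]
  have h1 : ((Metric.closedBall (0 : EuclideanSpace ℝ (Fin 3)) R)ᶜ).indicator
      (fun q : EuclideanSpace ℝ (Fin 3) => ((‖q‖ : ℝ) : ℂ) ^ s)
      = fun q => (Ioi R).indicator (fun y : ℝ => (y : ℂ) ^ s) ‖q‖ := by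
    ext q; simp [indicator]
  rw [h1, integrable_fun_norm_addHaar volume (f := (Ioi R).indicator (fun y : ℝ => (y : ℂ) ^ s))]
  have h2 : ∀ y ∈ Ioi (0:ℝ), y ^ (Module.finrank ℝ (EuclideanSpace ℝ (Fin 3)) - 1) •
      (Ioi R).indicator (fun y : ℝ => (y : ℂ) ^ s) y
      = (Ioi R).indicator (fun y : ℝ => (y : ℂ) ^ (s + 2)) y := by
    intro y hy
    by_cases h : y ∈ Ioi R
    · have : (y : ℂ) ≠ 0 := by exact_mod_cast (ne_of_gt hy)
      simp only [indicator_of_mem h, finrank_euclideanSpace, Fintype.card_fin]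
      rw [Complex.cpow_add _ _ this]
      simp [mul_comm]
    · simp [indicator_of_notMem h]
  rw [integrableOn_congr_fun h2 measurableSet_Ioi, integrableOn_indicator_iff measurableSet_Ioi,
    inter_eq_left.2 (Ioi_subset_Ioi hR.le), integrableOn_Ioi_cpow_iff hR]
  simp only [Complex.add_re, Complex.re_ofNat]
  constructor <;> intro h <;> linarith

open Set in
lemma aux_radial_val (R : ℝ) (hR : 0 < R) (s : ℂ) (hs : s.re < -3) :
    ∫ q in (Metric.closedBall (0 : EuclideanSpace ℝ (Fin 3)) R)ᶜ, ((‖q‖ : ℝ) : ℂ) ^ s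
      = 4 * Real.pi * (-(R : ℂ) ^ (s + 3) / (s + 3)) := by
  rw [← integral_indicator Metric.isClosed_closedBall.measurableSet.compl]
  have h1 : ((Metric.closedBall (0 : EuclideanSpace ℝ (Fin 3)) R)ᶜ).indicator
      (fun q : EuclideanSpace ℝ (Fin 3) => ((‖q‖ : ℝ) : ℂ) ^ s)
      = fun q => (Ioi R).indicator (fun y : ℝ => (y : ℂ) ^ s) ‖q‖ := by
    ext q; simp [indicator]
  rw [h1, integral_fun_norm_addHaar volume (f := (Ioi R).indicator (fun y : ℝ => (y : ℂ) ^ s))]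
  have h2 : ∀ y ∈ Ioi (0:ℝ), y ^ (Module.finrank ℝ (EuclideanSpace ℝ (Fin 3)) - 1) •
      (Ioi R).indicator (fun y : ℝ => (y : ℂ) ^ s) y
      = (Ioi R).indicator (fun y : ℝ => (y : ℂ) ^ (s + 2)) y := by
    intro y hy
    by_cases h : y ∈ Ioi R
    · have : (y : ℂ) ≠ 0 := by exact_mod_cast (ne_of_gt hy)
      simp only [indicator_of_mem h, finrank_euclideanSpace, Fintype.card_fin]
      rw [Complex.cpow_add _ _ this]
      simp [mul_comm]
    · simp [indicator_of_notMem h]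
  rw [setIntegral_congr_fun measurableSet_Ioi h2, setIntegral_indicator measurableSet_Ioi,
    inter_eq_right.2 (Ioi_subset_Ioi hR.le), integral_Ioi_cpow_of_lt (by simp; linarith) hR]
  have hv : (volume : Measure (EuclideanSpace ℝ (Fin 3))).real (Metric.ball 0 1)
      = Real.pi * 4 / 3 := by
    rw [Measure.real, EuclideanSpace.volume_ball_fin_three]
    simp; positivity
  rw [hv]
  simp only [finrank_euclideanSpace, Fintype.card_fin, nsmul_eq_mul, Complex.real_smul]
  have : s + 2 + 1 = s + 3 := by ring
  rw [this]; push_cast; ring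

/-- The integrand in exponential form. -/
noncomputable def eInt {N : ℕ} (p : Fin N → EuclideanSpace ℝ (Fin 3)) (w : Fin N → ℂ) (z : ℂ)
    (q : EuclideanSpace ℝ (Fin 3)) : ℂ :=
  Complex.exp (∑ i, (-2 * (w i + z / (N : ℂ))) * ((Real.log ‖q + p i‖ : ℝ) : ℂ))

lemma eInt_ae {N : ℕ} (p : Fin N → EuclideanSpace ℝ (Fin 3)) (w : Fin N → ℂ) (z : ℂ) :
    (fun q : EuclideanSpace ℝ (Fin 3) =>
      ∏ i, ((‖q + p i‖ : ℝ) : ℂ) ^ (-2 * (w i + z / (N : ℂ)))) =ᵐ[volume] eInt p w z := by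
  have h : ∀ᵐ q : EuclideanSpace ℝ (Fin 3), ∀ i, q ≠ - p i := by
    rw [ae_all_iff]; intro i
    simp [ae_iff]
  filter_upwards [h] with q hq
  rw [eInt, Complex.exp_sum]
  refine Finset.prod_congr rfl fun i _ => ?_
  have : ‖q + p i‖ ≠ 0 := by
    rw [norm_ne_zero_iff]; intro h0; exact hq i (eq_neg_of_add_eq_zero_left h0)
  rw [Complex.cpow_def_of_ne_zero (by exact_mod_cast this), Complex.ofReal_log (norm_nonneg _),
    mul_comm]

lemma eInt_meas {N : ℕ} (p : Fin N → EuclideanSpace ℝ (Fin 3)) (w : Fin N → ℂ) (z : ℂ) :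
    Measurable (eInt p w z) := by
  unfold eInt; fun_prop

lemma eInt_diff {N : ℕ} (p : Fin N → EuclideanSpace ℝ (Fin 3)) (w : Fin N → ℂ) (q) :
    Differentiable ℂ (fun z => eInt p w z q) := by
  unfold eInt; fun_prop

lemma eInt_ball {N : ℕ} (hN : 0 < N) (p : Fin N → EuclideanSpace ℝ (Fin 3)) (w : Fin N → ℂ)
    (z z1 : ℂ) (q) (M : ℝ) (hM : ∀ i, ‖q + p i‖ ≤ M) (h : z.re ≤ z1.re) :
    ‖eInt p w z q‖ ≤ ‖eInt p w z1 q‖ * Real.exp (2 * (z1.re - z.re) * M) := by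
  have hN' : (0:ℝ) < N := by exact_mod_cast hN
  unfold eInt
  rw [Complex.norm_exp, Complex.norm_exp, ← Real.exp_add, Real.exp_le_exp]
  have hre : ∀ z : ℂ, (∑ i, (-2 * (w i + z / (N : ℂ))) * ((Real.log ‖q + p i‖ : ℝ) : ℂ)).re
      = ∑ i, (-2 * ((w i).re + z.re / N)) * Real.log ‖q + p i‖ := by
    intro z
    rw [Complex.re_sum]
    refine Finset.sum_congr rfl fun i _ => ?_
    rw [Complex.re_mul_ofReal]
    congr 1
    have : z / (N : ℂ) = z / ((N : ℝ) : ℂ) := by simp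
    rw [this]
    simp
  rw [hre, hre]
  have h3 : 2 * (z1.re - z.re) * M = ∑ i : Fin N, 2 * ((z1.re - z.re) / N) * M := by
    simp; field_simp
  rw [h3, ← Finset.sum_add_distrib]
  refine Finset.sum_le_sum fun i _ => ?_
  have h4 : Real.log ‖q + p i‖ ≤ M := (Real.log_le_self (norm_nonneg _)).trans (hM i)
  have h5 : 0 ≤ (z1.re - z.re) / N := div_nonneg (by linarith) hN'.le
  have h6 := mul_le_mul_of_nonneg_left h4 h5
  have h7 : (z1.re - z.re) / N = z1.re / N - z.re / N := by ring
  rw [h7] at h6 ⊢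
  nlinarith [h6]

lemma log_diff {P : ℝ} (hP : 0 ≤ P) (q v : EuclideanSpace ℝ (Fin 3)) (hv : ‖v‖ ≤ P)
    (hq : 2 * P + 1 < ‖q‖) : |Real.log ‖q + v‖ - Real.log ‖q‖| ≤ 2 * P / ‖q‖ := by
  have hq0 : 0 < ‖q‖ := by linarith
  have h1 : ‖q + v‖ ≤ ‖q‖ + P := (norm_add_le _ _).trans (by linarith)
  have h2 : ‖q‖ - P ≤ ‖q + v‖ := by
    have := norm_sub_le (q + v) v
    simp at this; linarith
  have hx0 : 0 < ‖q + v‖ := by linarith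
  rw [abs_le]
  constructor
  · have := Real.log_le_sub_one_of_pos (div_pos hq0 hx0)
    rw [Real.log_div hq0.ne' hx0.ne'] at this
    have h3 : ‖q‖ / ‖q + v‖ - 1 ≤ 2 * P / ‖q‖ := by
      rw [div_sub_one hx0.ne', div_le_div_iff₀ hx0 hq0]
      nlinarith
    linarith
  · have := Real.log_le_sub_one_of_pos (div_pos hx0 hq0)
    rw [Real.log_div hx0.ne' hq0.ne'] at this
    have h3 : ‖q + v‖ / ‖q‖ - 1 ≤ 2 * P / ‖q‖ := by
      rw [div_sub_one hq0.ne', div_le_div_iff_of_pos_right hq0]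
      linarith
    linarith

lemma exp_sub_one_bound (x : ℂ) : ‖Complex.exp x - 1‖ ≤ ‖x‖ * Real.exp ‖x‖ := by
  simpa using Complex.norm_exp_sub_sum_le_norm_mul_exp x 1

/-- Exterior estimate. -/
lemma eInt_ext {N : ℕ} (hN : 0 < N) (p : Fin N → EuclideanSpace ℝ (Fin 3)) (w : Fin N → ℂ)
    (P : ℝ) (hP : 0 ≤ P) (hp : ∀ i, ‖p i‖ ≤ P) :
    ∃ C : ℝ, ∀ z ∈ Metric.ball (3 / 2 - ∑ i, w i : ℂ) (1 / 4), ∀ q, 2 * P + 1 < ‖q‖ →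
      ‖eInt p w z q - ((‖q‖ : ℝ) : ℂ) ^ (-2 * (∑ i, w i + z))‖ ≤ C * ‖q‖ ^ (-(7 / 2) : ℝ) := by
  have hN' : (N:ℂ) ≠ 0 := by exact_mod_cast hN.ne'
  have hN1 : (1:ℝ) ≤ N := by exact_mod_cast hN
  set z₀ : ℂ := 3 / 2 - ∑ i, w i with hz₀
  set D : ℝ := ∑ i, 2 * (‖w i‖ + (‖z₀‖ + 1)) * (2 * P) with hD
  have hD0 : 0 ≤ D := by positivity
  refine ⟨D * Real.exp D, fun z hz q hq => ?_⟩
  have hq1 : 1 < ‖q‖ := by linarith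
  have hq0 : 0 < ‖q‖ := by linarith
  set E : ℂ := ∑ i, (-2 * (w i + z / (N : ℂ))) *
    ((Real.log ‖q + p i‖ - Real.log ‖q‖ : ℝ) : ℂ) with hE
  have hzn : ‖z‖ ≤ ‖z₀‖ + 1 := by
    rw [Metric.mem_ball, dist_eq_norm] at hz
    have := norm_le_norm_add_norm_sub' z z₀
    linarith
  have hEn : ‖E‖ ≤ D / ‖q‖ := by
    rw [hD, Finset.sum_div]
    refine (norm_sum_le _ _).trans (Finset.sum_le_sum fun i _ => ?_)
    rw [norm_mul, norm_mul, Complex.norm_real, mul_div_assoc]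
    refine mul_le_mul ?_ (log_diff hP q (p i) (hp i) hq) (norm_nonneg _) (by positivity)
    rw [norm_neg, Complex.norm_ofNat]
    refine mul_le_mul_of_nonneg_left ((norm_add_le _ _).trans ?_) (by norm_num)
    rw [norm_div, Complex.norm_natCast]
    have : ‖z‖ / N ≤ ‖z‖ := div_le_self (norm_nonneg _) hN1
    linarith
  have hfac : eInt p w z q = ((‖q‖ : ℝ) : ℂ) ^ (-2 * (∑ i, w i + z)) * Complex.exp E := by
    rw [Complex.cpow_def_of_ne_zero (by exact_mod_cast hq0.ne'), ← Complex.exp_add, eInt,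
      ← Complex.ofReal_log hq0.le]
    congr 1
    rw [hE]
    simp only [Complex.ofReal_sub, mul_sub, Finset.sum_sub_distrib]
    have : ∑ i, -2 * (w i + z / (N:ℂ)) * ((Real.log ‖q‖ : ℝ) : ℂ)
        = ((Real.log ‖q‖ : ℝ) : ℂ) * (-2 * (∑ i, w i + z)) := by
      rw [← Finset.sum_mul, ← Finset.mul_sum, Finset.sum_add_distrib]
      simp
      field_simp
    rw [this]; ring
  have hW : 5 / 4 ≤ (∑ i, w i + z).re := by
    rw [Metric.mem_ball, dist_eq_norm] at hz
    have h1 := (Complex.abs_re_le_norm (z - z₀)).trans hz.le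
    have h2 := (abs_le.1 h1).1
    have : (z - z₀).re = (∑ i, w i + z).re - 3 / 2 := by
      rw [hz₀]; simp; ring
    linarith
  have hdq : D / ‖q‖ ≤ D := div_le_self hD0 hq1.le
  have hn : ‖((‖q‖ : ℝ) : ℂ) ^ (-2 * (∑ i, w i + z))‖ ≤ ‖q‖ ^ (-(5 / 2) : ℝ) := by
    rw [Complex.norm_cpow_eq_rpow_re_of_pos hq0]
    refine Real.rpow_le_rpow_of_exponent_le hq1.le ?_
    have : (-2 * (∑ i, w i + z)).re = -2 * (∑ i, w i + z).re := by
      simp [Complex.mul_re]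
    rw [this]; linarith
  have h7 : ‖q‖ ^ (-(7 / 2) : ℝ) = ‖q‖ ^ (-(5 / 2) : ℝ) / ‖q‖ := by
    rw [← Real.rpow_sub_one hq0.ne']; norm_num
  calc _ = ‖((‖q‖ : ℝ) : ℂ) ^ (-2 * (∑ i, w i + z))‖ * ‖Complex.exp E - 1‖ := by
        rw [hfac, ← norm_mul]; congr 1; ring
    _ ≤ ‖q‖ ^ (-(5 / 2) : ℝ) * ((D / ‖q‖) * Real.exp D) := by
        refine mul_le_mul hn ((exp_sub_one_bound E).trans ?_) (norm_nonneg _) (by positivity)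
        refine mul_le_mul hEn (Real.exp_le_exp.2 (hEn.trans hdq)) (by positivity) (by positivity)
    _ = _ := by rw [h7]; ring

lemma aux_reduce (z₀ L : ℂ) (Q : ℂ → Prop) (I G : ℂ → ℂ)
    (h1 : ∀ᶠ z in 𝓝[≠] z₀, Q z → G z = I z)
    (h2 : ∀ᶠ z in 𝓝[≠] z₀, DifferentiableAt ℂ G z)
    (h3 : Tendsto (fun z => (z - z₀) * G z) (𝓝[≠] z₀) (𝓝 L)) :
    ∃ F : ℂ → ℂ, (∀ z, Q z → F z = I z) ∧ (∀ᶠ z in 𝓝[≠] z₀, DifferentiableAt ℂ F z) ∧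
      Tendsto (fun z => (z - z₀) * F z) (𝓝[≠] z₀) (𝓝 L) := by
  classical
  have heq : ∀ᶠ z in 𝓝[≠] z₀, (if Q z then I z else G z) = G z := by
    filter_upwards [h1] with z hz
    split_ifs with h
    · exact (hz h).symm
    · rfl
  refine ⟨fun z => if Q z then I z else G z, fun z hz => if_pos hz, ?_, ?_⟩
  · filter_upwards [h2, eventually_eventually_nhdsWithin.2 heq, self_mem_nhdsWithin]
      with z hz he hne
    rw [isOpen_compl_singleton.nhdsWithin_eq hne] at he
    exact hz.congr_of_eventuallyEq he
  · refine h3.congr' ?_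
    filter_upwards [heq] with z hz
    rw [hz]

lemma core {N : ℕ} (hN : 0 < N) (p : Fin N → EuclideanSpace ℝ (Fin 3)) (w : Fin N → ℂ) :
    ∃ G : ℂ → ℂ,
      (∀ᶠ z in 𝓝[≠] (3 / 2 - ∑ i, w i), Integrable (eInt p w z) →
        G z = (1 / (2 * (Real.pi : ℂ)) ^ 3) * ∫ q, eInt p w z q) ∧
      (∀ᶠ z in 𝓝[≠] (3 / 2 - ∑ i, w i), DifferentiableAt ℂ G z) ∧
      Tendsto (fun z : ℂ => (z - (3 / 2 - ∑ i, w i)) * G z)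
        (𝓝[≠] (3 / 2 - ∑ i, w i)) (𝓝 (1 / (4 * (Real.pi : ℂ) ^ 2))) := by
  set P : ℝ := ∑ i, ‖p i‖ with hPdef
  have hP : 0 ≤ P := by positivity
  have hp : ∀ i, ‖p i‖ ≤ P := fun i =>
    Finset.single_le_sum (f := fun i => ‖p i‖) (fun _ _ => norm_nonneg _) (Finset.mem_univ i)
  obtain ⟨C, hC⟩ := eInt_ext hN p w P hP hp
  set R : ℝ := 2 * P + 1 with hRdef
  have hR : 0 < R := by positivity
  set S : ℂ := ∑ i, w i with hS
  set z₀ : ℂ := 3 / 2 - S with hz₀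
  set B : Set (EuclideanSpace ℝ (Fin 3)) := Metric.closedBall 0 R with hB
  have hBm : MeasurableSet B := Metric.isClosed_closedBall.measurableSet
  have hmemB : ∀ q, q ∈ Bᶜ ↔ R < ‖q‖ := by intro q; simp [hB]
  have hre : ∀ z : ℂ, (-2 * (S + z)).re = -3 - 2 * (z.re - z₀.re) := by
    intro z; rw [hz₀]; simp [Complex.mul_re]; ring
  set g : ℂ → EuclideanSpace ℝ (Fin 3) → ℂ :=
    fun z q => eInt p w z q - ((‖q‖ : ℝ) : ℂ) ^ (-2 * (S + z)) with hg
  have hgm : ∀ z, AEStronglyMeasurable (g z) (volume.restrict Bᶜ) := by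
    intro z
    have := eInt_meas p w z
    refine Measurable.aestronglyMeasurable ?_
    rw [hg]; fun_prop
  have hbI : IntegrableOn (fun q : EuclideanSpace ℝ (Fin 3) => C * ‖q‖ ^ (-(7 / 2) : ℝ)) Bᶜ := by
    refine Integrable.const_mul ?_ C
    have h := ((aux_radial_int R hR (-(7 / 2) : ℂ)).2 (by norm_num)).norm
    refine (integrable_congr ?_).1 h
    refine (ae_restrict_iff' hBm.compl).2 (Eventually.of_forall fun q hq => ?_)
    have hq0 : 0 < ‖q‖ := hR.trans ((hmemB q).1 hq)
    beta_reduce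
    rw [Complex.norm_cpow_eq_rpow_re_of_pos hq0]; norm_num
  have hgb : ∀ᵐ q ∂(volume.restrict Bᶜ), ∀ z ∈ Metric.ball z₀ (1 / 4),
      ‖g z q‖ ≤ C * ‖q‖ ^ (-(7 / 2) : ℝ) :=
    (ae_restrict_iff' hBm.compl).2 (Eventually.of_forall fun q hq z hz =>
      hC z hz q ((hmemB q).1 hq))
  have hgint : ∀ z ∈ Metric.ball z₀ (1 / 4), IntegrableOn (g z) Bᶜ := fun z hz =>
    Integrable.mono' hbI (hgm z) (hgb.mono fun q h => h z hz)
  have hgd : ∀ z ∈ Metric.ball z₀ (1 / 4),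
      DifferentiableAt ℂ (fun z => ∫ q in Bᶜ, g z q) z := by
    refine aux_holo _ g z₀ (1 / 4) hgm ?_ _ hbI hgb
    refine (ae_restrict_iff' hBm.compl).2 (Eventually.of_forall fun q hq => ?_)
    have hq0 : ((‖q‖ : ℝ) : ℂ) ≠ 0 := by
      exact_mod_cast (hR.trans ((hmemB q).1 hq)).ne'
    refine (eInt_diff p w q).sub ?_
    intro z
    exact DifferentiableAt.const_cpow (by fun_prop) (Or.inl hq0)
  have hrad : ∀ z ∈ Metric.ball z₀ (1 / 4), Integrable (eInt p w z) →
      IntegrableOn (fun q : EuclideanSpace ℝ (Fin 3) => ((‖q‖ : ℝ) : ℂ) ^ (-2 * (S + z))) Bᶜ := by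
    intro z hz hi
    have := (hi.integrableOn (s := Bᶜ)).sub (hgint z hz)
    refine this.congr (Eventually.of_forall fun q => ?_)
    simp [hg]
  have hpos : ∀ z ∈ Metric.ball z₀ (1 / 4), Integrable (eInt p w z) → z₀.re < z.re := by
    intro z hz hi
    have := (aux_radial_int R hR _).1 (hrad z hz hi)
    rw [hre] at this
    linarith
  have hball : Metric.ball z₀ (1 / 4) ∈ 𝓝[≠] z₀ :=
    mem_nhdsWithin_of_mem_nhds (Metric.ball_mem_nhds _ (by norm_num))
  have hpi : (Real.pi : ℂ) ≠ 0 := by exact_mod_cast Real.pi_ne_zero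
  by_cases hcase : ∃ z1 : ℂ, z₀.re < z1.re ∧ IntegrableOn (eInt p w z1) B
  · obtain ⟨z1, hz1, hi1⟩ := hcase
    set r : ℝ := min (1 / 4) (z1.re - z₀.re) with hr
    have hr0 : 0 < r := lt_min (by norm_num) (by linarith)
    have hrball : Metric.ball z₀ r ∈ 𝓝[≠] z₀ :=
      mem_nhdsWithin_of_mem_nhds (Metric.ball_mem_nhds _ hr0)
    have hsub : Metric.ball z₀ r ⊆ Metric.ball z₀ (1 / 4) :=
      Metric.ball_subset_ball (min_le_left _ _)
    have hKd : ∀ z ∈ Metric.ball z₀ r,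
        DifferentiableAt ℂ (fun z => ∫ q in B, eInt p w z q) z := by
      refine aux_holo _ (eInt p w) z₀ r (fun z => (eInt_meas p w z).aestronglyMeasurable)
        (Eventually.of_forall (eInt_diff p w))
        (fun q => ‖eInt p w z1 q‖ * Real.exp (2 * (z1.re - z₀.re + 1) * (R + P)))
        (hi1.norm.mul_const _) ?_
      refine (ae_restrict_iff' hBm).2 (Eventually.of_forall fun q hq z hz => ?_)
      rw [Metric.mem_ball, dist_eq_norm] at hz
      have h1 := abs_le.1 ((Complex.abs_re_le_norm (z - z₀)).trans hz.le)
      rw [Complex.sub_re] at h1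
      have hr1 : r ≤ 1 / 4 := min_le_left _ _
      have hr2 : r ≤ z1.re - z₀.re := min_le_right _ _
      refine (eInt_ball hN p w z z1 q (R + P) ?_ (by linarith)).trans ?_
      · intro i
        have : ‖q‖ ≤ R := by simpa [hB] using hq
        exact (norm_add_le _ _).trans (add_le_add this (hp i))
      · gcongr
        linarith
    set V : ℂ → ℂ := fun z => 2 * Real.pi * (R : ℂ) ^ (-2 * (S + z) + 3) with hV
    have hR0 : (R : ℂ) ≠ 0 := by exact_mod_cast hR.ne'
    have hVd : Differentiable ℂ V := by
      intro z
      refine DifferentiableAt.const_mul ?_ _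
      exact DifferentiableAt.const_cpow (by fun_prop) (Or.inl hR0)
    have hV0 : V z₀ = 2 * Real.pi := by
      have : -2 * (S + z₀) + 3 = 0 := by rw [hz₀]; ring
      simp only [hV, this]; simp
    set c : ℂ := 1 / (2 * (Real.pi : ℂ)) ^ 3 with hc
    refine ⟨fun z => c * ((∫ q in B, eInt p w z q) + (∫ q in Bᶜ, g z q) + V z / (z - z₀)),
      ?_, ?_, ?_⟩
    · filter_upwards [hball, self_mem_nhdsWithin] with z hz hne hi
      have hne' : z - z₀ ≠ 0 := sub_ne_zero.2 hne
      have h1 := hpos z hz hi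
      have h2 := aux_radial_val R hR (-2 * (S + z)) (by rw [hre]; linarith)
      have h3 : ∫ q in Bᶜ, g z q = (∫ q in Bᶜ, eInt p w z q)
          - ∫ q in Bᶜ, ((‖q‖ : ℝ) : ℂ) ^ (-2 * (S + z)) :=
        integral_sub hi.integrableOn (hrad z hz hi)
      rw [← integral_add_compl hBm hi, h3, h2]
      have h4 : -2 * (S + z) + 3 = -2 * (z - z₀) := by rw [hz₀]; ring
      simp only [hV, h4]
      field_simp
      ring
    · filter_upwards [hrball, self_mem_nhdsWithin] with z hz hne
      have hne' : z - z₀ ≠ 0 := sub_ne_zero.2 hne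
      refine DifferentiableAt.const_mul (((hKd z hz).add (hgd z (hsub hz))).add ?_) _
      exact (hVd z).div (by fun_prop) hne'
    · have hcont : Tendsto (fun z => c * ((z - z₀) *
          ((∫ q in B, eInt p w z q) + (∫ q in Bᶜ, g z q)) + V z)) (𝓝 z₀)
          (𝓝 (c * ((z₀ - z₀) *
          ((∫ q in B, eInt p w z₀ q) + (∫ q in Bᶜ, g z₀ q)) + V z₀))) := by
        have hk := (hKd z₀ (Metric.mem_ball_self hr0)).continuousAt.tendsto
        have hx := (hgd z₀ (Metric.mem_ball_self (by norm_num))).continuousAt.tendsto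
        have hv := (hVd z₀).continuousAt.tendsto
        have hid : Tendsto (fun z : ℂ => z - z₀) (𝓝 z₀) (𝓝 (z₀ - z₀)) :=
          tendsto_id.sub tendsto_const_nhds
        exact ((hid.mul (hk.add hx)).add hv).const_mul c
      have hval : c * ((z₀ - z₀) * ((∫ q in B, eInt p w z₀ q) + (∫ q in Bᶜ, g z₀ q)) + V z₀)
          = 1 / (4 * (Real.pi : ℂ) ^ 2) := by
        rw [hV0, hc, sub_self]; field_simp; ring
      rw [hval] at hcont
      refine (hcont.mono_left nhdsWithin_le_nhds).congr' ?_
      filter_upwards [self_mem_nhdsWithin] with z hne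
      have hne' : z - z₀ ≠ 0 := sub_ne_zero.2 hne
      field_simp
  · push Not at hcase
    refine ⟨fun z => 1 / (4 * (Real.pi : ℂ) ^ 2) / (z - z₀), ?_, ?_, ?_⟩
    · filter_upwards [hball] with z hz hi
      exact absurd hi.integrableOn (hcase z (hpos z hz hi))
    · filter_upwards [self_mem_nhdsWithin] with z hne
      have hne' : z - z₀ ≠ 0 := sub_ne_zero.2 hne
      exact (differentiableAt_const _).div (by fun_prop) hne'
    · refine tendsto_const_nhds.congr' ?_
      filter_upwards [self_mem_nhdsWithin] with z hne
      have hne' : z - z₀ ≠ 0 := sub_ne_zero.2 hne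
      field_simp

/-- Divergent part of a general Mellin-space loop integral: for
`L(z) = ∫ d³q/(2π)³ ∏_{i<N} |q + pᵢ|^{−2(wᵢ + z/N)}` (so the total exponent sum is
`W = Σwᵢ + z`), there is a function `F` agreeing with the integral wherever it
converges, analytic in a punctured neighbourhood of the point where `W = 3/2`,
with a simple pole there of residue `1/(4π²)`, independent of the `pᵢ`. -/
theorem stmt10 (N : ℕ) (hN : 0 < N) (p : Fin N → EuclideanSpace ℝ (Fin 3))
    (w : Fin N → ℂ) :
    ∃ F : ℂ → ℂ,
      (∀ z : ℂ,
        Integrable (fun q : EuclideanSpace ℝ (Fin 3) =>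
            ∏ i, ((‖q + p i‖ : ℝ) : ℂ) ^ (-2 * (w i + z / (N : ℂ)))) →
        F z = (1 / (2 * (Real.pi : ℂ)) ^ 3) *
          ∫ q : EuclideanSpace ℝ (Fin 3),
            ∏ i, ((‖q + p i‖ : ℝ) : ℂ) ^ (-2 * (w i + z / (N : ℂ)))) ∧
      (∀ᶠ z in 𝓝[≠] (3 / 2 - ∑ i, w i), DifferentiableAt ℂ F z) ∧
      Tendsto (fun z : ℂ => (z - (3 / 2 - ∑ i, w i)) * F z)
        (𝓝[≠] (3 / 2 - ∑ i, w i)) (𝓝 (1 / (4 * (Real.pi : ℂ) ^ 2))) := by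
  obtain ⟨G, h1, h2, h3⟩ := core hN p w
  refine aux_reduce _ _ _ _ G ?_ h2 h3
  filter_upwards [h1] with z hz hi
  rw [hz ((integrable_congr (eInt_ae p w z)).1 hi), integral_congr_ae (eInt_ae p w z)]
end
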